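/- Let μ be a probability measure on ℝ^d with mean vector m ∈ ℝ^d and covariance matrix Σ (positive definite), i.e., ∫ (x_i − m_i)(x_j − m_j) dμ(x) = Σ_{ij} for all i,j, and suppose KL(μ ∥ N(m,Σ)) < ∞, where N(m,Σ) is the multivariate Gaussian measure on ℝ^d with mean m and covariance Σ. For a probability measure ρ on ℝ^d and D > 0, define the perfect-realism rate-distortion-perception function R_PR(ρ, D) = inf { KL(π ∥ ρ ⊗ ρ) : π a probability measure on ℝ^d × ℝ^d with both marginals equal to ρ and ∫ ‖x − y‖² dπ(x,y) ≤ D }. Then for every D > 0: R_PR(μ, D) ≥ R_PR(N(m,Σ), D) − KL(μ ∥ N(m,Σ)). (Shannon lower bound for the perfect-realism RDPF under mean-squared-error distortion; the correction term −KL(μ ∥ N(m,Σ)) equals the differential entropy difference h(X) − h(X*) of Theorem 5 when the covariance of μ equals Σ.) -/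

import Mathlib

open MeasureTheory
open scoped ENNReal NNReal Classical

/-- Kullback–Leibler divergence, valued in `[0,∞]`: `∫ log (dP/dQ) dP` when `P ≪ Q`
(and the log-likelihood ratio is integrable), `+∞` otherwise. -/
noncomputable def KL {α : Type*} [MeasurableSpace α] (P Q : Measure α) : ℝ≥0∞ :=
  if P ≪ Q ∧ Integrable (llr P Q) P then ENNReal.ofReal (∫ x, llr P Q x ∂P) else ⊤

/-- The perfect-realism rate-distortion-perception function of `ρ` at distortion level `D`
under squared-error distortion. -/
noncomputable def RPR {d : ℕ} (ρ : Measure (Fin d → ℝ)) (D : ℝ) : ℝ≥0∞ :=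
  sInf {r : ℝ≥0∞ | ∃ π : Measure ((Fin d → ℝ) × (Fin d → ℝ)), IsProbabilityMeasure π ∧
    π.fst = ρ ∧ π.snd = ρ ∧
    (∫⁻ p, ENNReal.ofReal (∑ i, (p.1 i - p.2 i) ^ 2) ∂π) ≤ ENNReal.ofReal D ∧
    r = KL π (ρ.prod ρ)}

open ProbabilityTheory

/-- The law of `b + B Z`, where `Z` is a vector of independent standard Gaussians. -/
noncomputable def affineGaussian {κ ι : Type*} [Fintype ι] (b : κ → ℝ) (B : Matrix κ ι ℝ) :
    Measure (κ → ℝ) :=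
  (Measure.pi fun _ : ι => gaussianReal 0 1).map fun x i => b i + ∑ j, B i j * x j

theorem measurable_affine {κ ι : Type*} [Fintype ι] (b : κ → ℝ) (B : Matrix κ ι ℝ) :
    Measurable fun (x : ι → ℝ) i => b i + ∑ j, B i j * x j :=
  measurable_pi_lambda _ fun i => by fun_prop

instance {κ ι : Type*} [Fintype ι] (b : κ → ℝ) (B : Matrix κ ι ℝ) :
    IsProbabilityMeasure (affineGaussian b B) :=
  Measure.isProbabilityMeasure_map (measurable_affine b B).aemeasurable

theorem charFunDual_pi_gaussianReal {ι : Type*} [Fintype ι] (L : StrongDual ℝ (ι → ℝ)) :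
    charFunDual (Measure.pi fun _ : ι => gaussianReal 0 1) L
      = Complex.exp (-(∑ i, (L (Pi.single i 1)) ^ 2 : ℝ) / 2) := by
  rw [charFunDual_pi]
  have key : ∀ i, charFunDual (gaussianReal 0 1) (L.comp (.single ℝ (fun _ : ι => ℝ) i))
      = Complex.exp (-((L (Pi.single i 1)) ^ 2 : ℝ) / 2) := by
    intro i
    rw [charFunDual_eq_charFun_map_one]
    have : (⇑(L.comp (.single ℝ (fun _ : ι => ℝ) i)) : ℝ → ℝ) = fun x => L (Pi.single i 1) * x := by
      ext x
      simp only [ContinuousLinearMap.comp_apply, ContinuousLinearMap.single_apply]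
      have : (Pi.single i x : ι → ℝ) = x • Pi.single i 1 := by
        rw [← Pi.single_smul]; simp
      rw [this, map_smul, smul_eq_mul, mul_comm]
    rw [this, gaussianReal_map_const_mul, charFun_gaussianReal]
    simp [neg_div]
  simp_rw [key]
  rw [← Complex.exp_sum]
  congr 1
  push_cast
  rw [neg_div, Finset.sum_div, ← Finset.sum_neg_distrib]
  simp [neg_div]

theorem affineGaussian_eq_map_add {κ ι : Type*} [Fintype ι] [Fintype κ] (b : κ → ℝ)
    (B : Matrix κ ι ℝ) :
    affineGaussian b B = ((Measure.pi fun _ : ι => gaussianReal 0 1).map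
      (LinearMap.toContinuousLinearMap (Matrix.toLin' B))).map (fun x => b + x) := by
  rw [Measure.map_map (by fun_prop) (by fun_prop)]
  rfl

theorem sum_sq_toLin_single {κ ι : Type*} [Fintype ι] [Fintype κ] (B : Matrix κ ι ℝ)
    (L : StrongDual ℝ (κ → ℝ)) :
    ∑ i, ((L.comp (LinearMap.toContinuousLinearMap (Matrix.toLin' B))) (Pi.single i 1)) ^ 2
      = ∑ k, ∑ l, L (Pi.single k 1) * L (Pi.single l 1) * (B * B.transpose) k l := by
  have h : ∀ i, (L.comp (LinearMap.toContinuousLinearMap (Matrix.toLin' B))) (Pi.single i 1)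
      = ∑ k, L (Pi.single k 1) * B k i := by
    intro i
    have : B.mulVec (Pi.single i 1) = ∑ k, B k i • (Pi.single k 1 : κ → ℝ) := by
      ext k; simp [Pi.single_apply]
    simp [this, mul_comm]
  simp_rw [h, Matrix.mul_apply, Matrix.transpose_apply, sq, Finset.sum_mul_sum, Finset.mul_sum]
  rw [Finset.sum_comm]
  refine Finset.sum_congr rfl fun k _ => ?_
  rw [Finset.sum_comm]
  refine Finset.sum_congr rfl fun l _ => Finset.sum_congr rfl fun i _ => by ring

/-- The Gaussian law of `b + B Z` depends on `B` only through `B Bᵀ`. -/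
theorem affineGaussian_congr {κ ι ι' : Type*} [Fintype ι] [Fintype ι'] [Fintype κ] (b : κ → ℝ)
    {B : Matrix κ ι ℝ} {B' : Matrix κ ι' ℝ}
    (h : B * B.transpose = B' * B'.transpose) : affineGaussian b B = affineGaussian b B' := by
  rw [affineGaussian_eq_map_add, affineGaussian_eq_map_add]
  congr 1
  have := Measure.isProbabilityMeasure_map (μ := Measure.pi fun _ : ι => gaussianReal 0 1)
    (f := LinearMap.toContinuousLinearMap (Matrix.toLin' B)) (by fun_prop)
  have := Measure.isProbabilityMeasure_map (μ := Measure.pi fun _ : ι' => gaussianReal 0 1)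
    (f := LinearMap.toContinuousLinearMap (Matrix.toLin' B')) (by fun_prop)
  apply Measure.ext_of_charFunDual
  ext L
  rw [charFunDual_map, charFunDual_map, charFunDual_pi_gaussianReal, charFunDual_pi_gaussianReal,
    sum_sq_toLin_single, sum_sq_toLin_single, h]

theorem integrable_mul_pi_gaussianReal {ι : Type*} [Fintype ι] (k l : ι) :
    Integrable (fun z : ι → ℝ => z k * z l) (Measure.pi fun _ : ι => gaussianReal 0 1) := by
  have h : ∀ k, MemLp (fun z : ι → ℝ => z k) 2 (Measure.pi fun _ : ι => gaussianReal 0 1) :=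
    fun k => (memLp_id_gaussianReal 2).comp_measurePreserving
      (measurePreserving_eval (fun _ : ι => gaussianReal 0 1) k)
  exact (h k).integrable_mul (h l)

theorem integral_mul_pi_gaussianReal {ι : Type*} [Fintype ι] (k l : ι) :
    ∫ z : ι → ℝ, z k * z l ∂(Measure.pi fun _ : ι => gaussianReal 0 1)
      = (1 : Matrix ι ι ℝ) k l := by
  have hev := fun k => measurePreserving_eval (fun _ : ι => gaussianReal 0 1) k
  by_cases hkl : k = l
  · subst hkl
    have h1 : ∫ x, x * x ∂(gaussianReal 0 1) = 1 := by
      have := variance_fun_id_gaussianReal (μ := 0) (v := 1)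
      rw [variance_eq_integral (by fun_prop)] at this
      simpa [sq] using this
    have := integral_map (μ := Measure.pi fun _ : ι => gaussianReal 0 1)
      (φ := Function.eval k) (f := fun x : ℝ => x * x) (hev k).measurable.aemeasurable (by fun_prop)
    rw [(hev k).map_eq, h1] at this
    simpa using this.symm
  · have hind := (iIndepFun_pi (μ := fun _ : ι => gaussianReal 0 1) (X := fun _ x => x)
      (fun _ => by fun_prop)).indepFun hkl
    have := hind.integral_mul_eq_mul_integral (hev k).measurable.aestronglyMeasurable
      (hev l).measurable.aestronglyMeasurable
    have h0 := integral_map (μ := Measure.pi fun _ : ι => gaussianReal 0 1)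
      (φ := Function.eval k) (f := fun x : ℝ => x) (hev k).measurable.aemeasurable (by fun_prop)
    rw [(hev k).map_eq, integral_id_gaussianReal] at h0
    simp only [Function.eval] at h0
    rw [← h0, zero_mul] at this
    rw [Matrix.one_apply_ne hkl]
    exact this

theorem secondMoment_affineGaussian {κ ι : Type*} [Fintype ι] (b : κ → ℝ)
    (B : Matrix κ ι ℝ) (k l : κ) :
    Integrable (fun w => (w k - b k) * (w l - b l)) (affineGaussian b B) ∧
      ∫ w, (w k - b k) * (w l - b l) ∂(affineGaussian b B) = (B * B.transpose) k l := by
  have hexp : ∀ z : ι → ℝ, (∑ j, B k j * z j) * (∑ j, B l j * z j)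
      = ∑ i, ∑ j, B k i * B l j * (z i * z j) := fun z => by
    rw [Finset.sum_mul_sum]
    exact Finset.sum_congr rfl fun i _ => Finset.sum_congr rfl fun j _ => by ring
  have hi : ∀ i j, Integrable (fun z : ι → ℝ => B k i * B l j * (z i * z j))
      (Measure.pi fun _ : ι => gaussianReal 0 1) :=
    fun i j => (integrable_mul_pi_gaussianReal i j).const_mul _
  constructor
  · rw [affineGaussian, integrable_map_measure (by fun_prop) (measurable_affine b B).aemeasurable]
    simp only [Function.comp_def, add_sub_cancel_left, hexp]
    exact integrable_finsetSum _ fun i _ => integrable_finsetSum _ fun j _ => hi i j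
  · rw [affineGaussian, integral_map (measurable_affine b B).aemeasurable (by fun_prop)]
    simp only [add_sub_cancel_left, hexp]
    rw [integral_finsetSum _ fun i _ => integrable_finsetSum _ fun j _ => hi i j]
    simp_rw [integral_finsetSum _ fun j _ => hi _ j, integral_const_mul,
      integral_mul_pi_gaussianReal]
    simp [Matrix.one_apply, Matrix.mul_apply]

theorem map_withDensity_of_leftInverse {α β : Type*} [MeasurableSpace α] [MeasurableSpace β]
    (μ : Measure α) {f : α → ℝ≥0∞} (hf : Measurable f) {T : α → β} (hT : Measurable T)
    {T' : β → α} (hT' : Measurable T') (h : Function.LeftInverse T' T) :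
    (μ.withDensity f).map T = (μ.map T).withDensity (f ∘ T') := by
  ext s hs
  rw [Measure.map_apply hT hs, withDensity_apply _ (hT hs), withDensity_apply _ hs,
    setLIntegral_map hs (hf.comp hT') hT]
  simp only [Function.comp_apply, h _]

theorem pi_gaussianReal_eq_withDensity (ι : Type*) [Fintype ι] :
    ∃ c : ℝ, (Measure.pi fun _ : ι => gaussianReal 0 1)
      = volume.withDensity fun z => ENNReal.ofReal (Real.exp (c - (∑ i, z i ^ 2) / 2)) := by
  refine ⟨Fintype.card ι * Real.log (√(2 * Real.pi))⁻¹, ?_⟩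
  have hpdf : ∀ z : ι → ℝ, Real.exp (Fintype.card ι * Real.log (√(2 * Real.pi))⁻¹
      - (∑ i, z i ^ 2) / 2) = ∏ i, gaussianPDFReal 0 1 (z i) := fun z => by
    have hpos : 0 < (√(2 * Real.pi))⁻¹ := by positivity
    simp only [gaussianPDFReal, NNReal.coe_one, mul_one, sub_zero]
    rw [Finset.prod_mul_distrib, ← Real.exp_sum, sub_eq_add_neg, Real.exp_add, Finset.prod_const,
      Finset.card_univ, Real.exp_nat_mul, Real.exp_log hpos]
    simp [neg_div, Finset.sum_div]
  simp_rw [hpdf]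
  refine Measure.pi_eq fun s hs => ?_
  rw [withDensity_apply _ (MeasurableSet.univ_pi hs), volume_pi, Measure.restrict_pi_pi,
    ← ofReal_integral_eq_lintegral_ofReal
      (Integrable.fintype_prod fun i => (integrable_gaussianPDFReal 0 1).restrict)
      (ae_of_all _ fun z => Finset.prod_nonneg fun i _ => gaussianPDFReal_nonneg _ _ _),
    integral_fintype_prod_eq_prod, ENNReal.ofReal_prod_of_nonneg
      (fun i _ => integral_nonneg fun _ => gaussianPDFReal_nonneg _ _ _)]
  refine Finset.prod_congr rfl fun i _ => ?_
  rw [gaussianReal_apply_eq_integral _ one_ne_zero]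

theorem affineGaussian_eq_withDensity {ι : Type*} [Fintype ι] [DecidableEq ι] (b : ι → ℝ) {C : Matrix ι ι ℝ}
    (hC : C.det ≠ 0) :
    ∃ c : ℝ, affineGaussian b C = volume.withDensity fun w =>
      ENNReal.ofReal (Real.exp (c - (∑ i, (∑ j, C⁻¹ i j * (w j - b j)) ^ 2) / 2)) := by
  obtain ⟨c, hc⟩ := pi_gaussianReal_eq_withDensity ι
  have hpos : 0 < |C.det⁻¹| := abs_pos.2 (inv_ne_zero hC)
  refine ⟨Real.log |C.det⁻¹| + c, ?_⟩
  have hinv : Function.LeftInverse (fun (w : ι → ℝ) i => ∑ j, C⁻¹ i j * (w j - b j))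
      (fun (x : ι → ℝ) i => b i + ∑ j, C i j * x j) := fun x => by
    simp only [add_sub_cancel_left]
    change C⁻¹.mulVec (C.mulVec x) = x
    rw [Matrix.mulVec_mulVec, Matrix.nonsing_inv_mul _ (isUnit_iff_ne_zero.2 hC),
      Matrix.one_mulVec]
  have hvol : (volume : Measure (ι → ℝ)).map (fun x i => b i + ∑ j, C i j * x j)
      = ENNReal.ofReal |C.det⁻¹| • volume := by
    have : (fun (x : ι → ℝ) i => b i + ∑ j, C i j * x j)
        = (fun x => b + x) ∘ Matrix.toLin' C := rfl
    rw [this, ← Measure.map_map (by fun_prop)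
      (LinearMap.continuous_of_finiteDimensional _).measurable,
      Real.map_matrix_volume_pi_eq_smul_volume_pi hC, Measure.map_smul, map_add_left_eq_self]
  rw [affineGaussian, hc, map_withDensity_of_leftInverse _ (by fun_prop) (measurable_affine b C)
    (measurable_pi_lambda _ fun i => by fun_prop) hinv, hvol, withDensity_smul_measure,
    ← withDensity_smul _ (by
      refine Measurable.comp (by fun_prop) (measurable_pi_lambda _ fun i => by fun_prop))]
  congr 1
  ext w
  rw [Pi.smul_apply, smul_eq_mul, Function.comp_apply, ← ENNReal.ofReal_mul hpos.le, add_sub_assoc,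
    Real.exp_add, Real.exp_log hpos]

/-- Two nondegenerate Gaussian laws with a common center have log-density ratio given by a
difference of quadratic forms. -/
theorem affineGaussian_eq_withDensity_affineGaussian {ι : Type*} [Fintype ι] [DecidableEq ι] (b : ι → ℝ)
    {C D : Matrix ι ι ℝ} (hC : C.det ≠ 0) (hD : D.det ≠ 0) :
    ∃ c : ℝ, affineGaussian b C = (affineGaussian b D).withDensity fun w =>
      ENNReal.ofReal (Real.exp (c - (∑ i, (∑ j, C⁻¹ i j * (w j - b j)) ^ 2) / 2
        + (∑ i, (∑ j, D⁻¹ i j * (w j - b j)) ^ 2) / 2)) := by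
  obtain ⟨c, hc⟩ := affineGaussian_eq_withDensity b hC
  obtain ⟨d, hd⟩ := affineGaussian_eq_withDensity b hD
  refine ⟨c - d, ?_⟩
  rw [hc, hd, ← withDensity_mul _ (by fun_prop) (by fun_prop)]
  congr 1
  ext w
  rw [Pi.mul_apply, ← ENNReal.ofReal_mul (by positivity), ← Real.exp_add]
  congr 2
  ring

theorem affineGaussian_prod {κ ι : Type*} [Fintype κ] [Fintype ι] (b : κ → ℝ) (A : Matrix κ ι ℝ) :
    (affineGaussian b A).prod (affineGaussian b A)
      = (affineGaussian (Sum.elim b b) (Matrix.fromBlocks A 0 0 A)).map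
        (MeasurableEquiv.sumPiEquivProdPi fun _ => ℝ) := by
  have := (measurePreserving_sumPiEquivProdPi (ι := ι) (ι' := ι) (X := fun _ => ℝ)
    fun _ => gaussianReal 0 1).map_eq
  rw [affineGaussian, Measure.map_prod_map _ _ (measurable_affine b A) (measurable_affine b A),
    ← this, Measure.map_map (by fun_prop) (MeasurableEquiv.measurable _), affineGaussian,
    Measure.map_map (MeasurableEquiv.measurable _) (measurable_affine _ _)]
  congr 1
  ext x i <;> simp [MeasurableEquiv.sumPiEquivProdPi, Equiv.sumPiEquivProdPi]

theorem fst_map_affineGaussian {κ κ' ι : Type*} [Fintype κ] [Fintype κ'] [Fintype ι]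
    (b : κ → ℝ) (b' : κ' → ℝ) (C : Matrix (κ ⊕ κ') ι ℝ) :
    ((affineGaussian (Sum.elim b b') C).map (MeasurableEquiv.sumPiEquivProdPi fun _ => ℝ)).fst
      = affineGaussian b (C.submatrix Sum.inl id) := by
  rw [Measure.fst, Measure.map_map measurable_fst (MeasurableEquiv.measurable _), affineGaussian,
    Measure.map_map (by fun_prop) (measurable_affine _ _)]
  rfl

theorem snd_map_affineGaussian {κ κ' ι : Type*} [Fintype κ] [Fintype κ'] [Fintype ι]
    (b : κ → ℝ) (b' : κ' → ℝ) (C : Matrix (κ ⊕ κ') ι ℝ) :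
    ((affineGaussian (Sum.elim b b') C).map (MeasurableEquiv.sumPiEquivProdPi fun _ => ℝ)).snd
      = affineGaussian b' (C.submatrix Sum.inr id) := by
  rw [Measure.snd, Measure.map_map measurable_snd (MeasurableEquiv.measurable _), affineGaussian,
    Measure.map_map (by fun_prop) (measurable_affine _ _)]
  rfl

theorem KL_eq_klDiv {α : Type*} [MeasurableSpace α] (P Q : Measure α) [IsProbabilityMeasure P]
    [IsProbabilityMeasure Q] : KL P Q = InformationTheory.klDiv P Q := by
  rw [KL, InformationTheory.klDiv]
  simp

theorem KL_lt_top_iff {α : Type*} [MeasurableSpace α] {P Q : Measure α} :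
    KL P Q < ⊤ ↔ P ≪ Q ∧ Integrable (llr P Q) P := by
  rw [KL]
  split_ifs with h <;> simp [h]

theorem KL_eq_ofReal {α : Type*} [MeasurableSpace α] {P Q : Measure α} (hPQ : P ≪ Q)
    (hint : Integrable (llr P Q) P) : KL P Q = ENNReal.ofReal (∫ x, llr P Q x ∂P) :=
  if_pos ⟨hPQ, hint⟩

theorem integral_llr_nonneg {α : Type*} [MeasurableSpace α] {P Q : Measure α}
    [IsProbabilityMeasure P] [IsProbabilityMeasure Q] (hPQ : P ≪ Q)
    (hint : Integrable (llr P Q) P) : 0 ≤ ∫ x, llr P Q x ∂P := by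
  simpa using InformationTheory.integral_llr_add_sub_measure_univ_nonneg hPQ hint

theorem llr_ae_eq_add_llr {α : Type*} [MeasurableSpace α] {P Q R : Measure α} [SigmaFinite P]
    [SigmaFinite Q] [SigmaFinite R] (hPQ : P ≪ Q) (hQR : Q ≪ R) :
    llr P R =ᵐ[P] fun x => llr P Q x + llr Q R x := by
  filter_upwards [(hPQ.trans hQR).ae_le (Measure.rnDeriv_mul_rnDeriv (κ := R) hPQ),
    Measure.rnDeriv_pos hPQ, hPQ.ae_le (Measure.rnDeriv_lt_top P Q),
    hPQ.ae_le (Measure.rnDeriv_pos hQR),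
    (hPQ.trans hQR).ae_le (Measure.rnDeriv_lt_top Q R)] with x h h1 h2 h3 h4
  simp only [llr]
  rw [← h, Pi.mul_apply, ENNReal.toReal_mul, Real.log_mul (ENNReal.toReal_pos h1.ne' h2.ne).ne'
    (ENNReal.toReal_pos h3.ne' h4.ne).ne']

theorem llr_withDensity_exp {α : Type*} [MeasurableSpace α] (R : Measure α) [SigmaFinite R]
    {f : α → ℝ} (hf : Measurable f) :
    llr (R.withDensity fun x => ENNReal.ofReal (Real.exp (f x))) R =ᵐ[R] f := by
  filter_upwards [Measure.rnDeriv_withDensity R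
    (f := fun x => ENNReal.ofReal (Real.exp (f x))) (by fun_prop)] with x hx
  rw [llr, hx, ENNReal.toReal_ofReal (Real.exp_pos _).le, Real.log_exp]

theorem llr_prod_ae_eq {α β : Type*} [MeasurableSpace α] [MeasurableSpace β] {μ γ : Measure α}
    {μ' γ' : Measure β} [IsProbabilityMeasure μ] [IsProbabilityMeasure γ]
    [IsProbabilityMeasure μ'] [IsProbabilityMeasure γ'] (h : μ ≪ γ) (h' : μ' ≪ γ') :
    llr (μ.prod μ') (γ.prod γ') =ᵐ[μ.prod μ'] fun p => llr μ γ p.1 + llr μ' γ' p.2 := by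
  have hac : μ.prod μ' ≪ γ.prod γ' := h.prod h'
  have key : (μ.prod μ').rnDeriv (γ.prod γ') =ᵐ[γ.prod γ']
      fun p => μ.rnDeriv γ p.1 * μ'.rnDeriv γ' p.2 := by
    have hprod : μ.prod μ'
        = (γ.prod γ').withDensity fun p => μ.rnDeriv γ p.1 * μ'.rnDeriv γ' p.2 := by
      rw [← prod_withDensity (by fun_prop) (by fun_prop), Measure.withDensity_rnDeriv_eq _ _ h,
        Measure.withDensity_rnDeriv_eq _ _ h']
    conv_lhs => rw [hprod]
    exact Measure.rnDeriv_withDensity _ (by fun_prop)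
  have q1 := Measure.quasiMeasurePreserving_fst (μ := μ) (ν := μ')
  have q2 := Measure.quasiMeasurePreserving_snd (μ := μ) (ν := μ')
  filter_upwards [hac.ae_le key, q1.ae (Measure.rnDeriv_pos h),
    q1.ae (h.ae_le (Measure.rnDeriv_lt_top μ γ)), q2.ae (Measure.rnDeriv_pos h'),
    q2.ae (h'.ae_le (Measure.rnDeriv_lt_top μ' γ'))] with p hp h1 h2 h3 h4
  simp only [llr]
  rw [hp, ENNReal.toReal_mul, Real.log_mul (ENNReal.toReal_pos h1.ne' h2.ne).ne'
    (ENNReal.toReal_pos h3.ne' h4.ne).ne']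

/-- If `Q` is a coupling with first marginal `γ` whose log-density with respect to `γ ⊗ γ` has the
same expectation under `Q` and under a coupling `π` of `μ` with itself, then the mutual information
of `Q` exceeds that of `π` by at most `KL(μ ∥ γ)`. -/
theorem KL_le_add_of_integral_eq {α : Type*} [MeasurableSpace α] {π Q : Measure (α × α)}
    {μ γ : Measure α} [IsProbabilityMeasure π] [IsProbabilityMeasure Q] [IsProbabilityMeasure μ]
    [IsProbabilityMeasure γ] (hfst : π.fst = μ) (hsnd : π.snd = μ) (hQfst : Q.fst = γ)
    (hμ : KL μ γ < ⊤) (hπ : KL π (μ.prod μ) < ⊤) {f : α × α → ℝ} (hf : Measurable f)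
    (hQ : Q = (γ.prod γ).withDensity fun p => ENNReal.ofReal (Real.exp (f p)))
    (hfπ : Integrable f π) (hfQ : Integrable f Q) (heq : ∫ p, f p ∂π = ∫ p, f p ∂Q) :
    KL Q (γ.prod γ) ≤ KL π (μ.prod μ) + KL μ γ := by
  obtain ⟨hμγ, hiμ⟩ := KL_lt_top_iff.1 hμ
  obtain ⟨hπμ, hiπ⟩ := KL_lt_top_iff.1 hπ
  have hprod : μ.prod μ ≪ γ.prod γ := hμγ.prod hμγ
  have hQR : Q ≪ γ.prod γ := hQ ▸ withDensity_absolutelyContinuous _ _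
  have hRQ : γ.prod γ ≪ Q := by
    rw [hQ]
    exact withDensity_absolutelyContinuous' (by fun_prop)
      (ae_of_all _ fun p => by simp [Real.exp_pos])
  have hπR : π ≪ γ.prod γ := hπμ.trans hprod
  have hπQ : π ≪ Q := hπR.trans hRQ
  have hllrQ : llr Q (γ.prod γ) =ᵐ[γ.prod γ] f := by
    conv_lhs => rw [hQ]
    exact llr_withDensity_exp _ hf
  have hKLQ : KL Q (γ.prod γ) = ENNReal.ofReal (∫ p, f p ∂Q) := by
    rw [KL_eq_ofReal hQR (hfQ.congr (Filter.EventuallyEq.symm (hQR.ae_le hllrQ))), integral_congr_ae (hQR.ae_le hllrQ)]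
  have hp1 : MeasurePreserving Prod.fst π μ := ⟨measurable_fst, hfst⟩
  have hp2 : MeasurePreserving Prod.snd π μ := ⟨measurable_snd, hsnd⟩
  have hi1 : Integrable (fun p : α × α => llr μ γ p.1) π := hp1.integrable_comp_of_integrable hiμ
  have hi2 : Integrable (fun p : α × α => llr μ γ p.2) π := hp2.integrable_comp_of_integrable hiμ
  have he1 : ∫ p : α × α, llr μ γ p.1 ∂π = ∫ x, llr μ γ x ∂μ := by
    rw [← hfst, Measure.fst, integral_map (by fun_prop)
      (measurable_llr _ _).aestronglyMeasurable]
  have he2 : ∫ p : α × α, llr μ γ p.2 ∂π = ∫ x, llr μ γ x ∂μ := by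
    rw [← hsnd, Measure.snd, integral_map (by fun_prop)
      (measurable_llr _ _).aestronglyMeasurable]
  have hllr : llr π Q =ᵐ[π]
      fun p => llr π (μ.prod μ) p + (llr μ γ p.1 + llr μ γ p.2) - f p := by
    filter_upwards [llr_ae_eq_add_llr hπQ hQR, llr_ae_eq_add_llr hπμ hprod, hπR.ae_le hllrQ,
      hπμ.ae_le (llr_prod_ae_eq hμγ hμγ)] with p h1 h2 h3 h4
    linarith
  have hiQ : Integrable (llr π Q) π := ((hiπ.add (hi1.add hi2)).sub hfπ).congr hllr.symm
  have hint : ∫ p, llr π Q p ∂π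
      = ∫ p, llr π (μ.prod μ) p ∂π + (∫ x, llr μ γ x ∂μ + ∫ x, llr μ γ x ∂μ) - ∫ p, f p ∂Q := by
    have h1 : ∫ p, (llr μ γ p.1 + llr μ γ p.2) ∂π = _ := integral_add hi1 hi2
    have h2 : ∫ p, (llr π (μ.prod μ) p + (llr μ γ p.1 + llr μ γ p.2)) ∂π = _ :=
      integral_add hiπ (hi1.add hi2)
    have h3 : ∫ p, (llr π (μ.prod μ) p + (llr μ γ p.1 + llr μ γ p.2) - f p) ∂π = _ :=
      integral_sub (hiπ.add (hi1.add hi2)) hfπ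
    rw [integral_congr_ae hllr, h3, ← heq, ← he1]
    congr 1
    refine h2.trans ?_
    congr 1
    refine h1.trans ?_
    rw [he2, he1]
  have hdpi : KL μ γ ≤ KL π Q := by
    rw [KL_eq_klDiv, KL_eq_klDiv, ← hfst, ← hQfst]
    exact InformationTheory.klDiv_map_le π Q measurable_fst
  rw [KL_eq_ofReal hμγ hiμ, KL_eq_ofReal hπQ hiQ,
    ENNReal.ofReal_le_ofReal_iff (integral_llr_nonneg hπQ hiQ)] at hdpi
  rw [hKLQ, KL_eq_ofReal hπμ hiπ, KL_eq_ofReal hμγ hiμ,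
    ← ENNReal.ofReal_add (integral_llr_nonneg hπμ hiπ) (integral_llr_nonneg hμγ hiμ)]
  exact ENNReal.ofReal_le_ofReal (by linarith)

theorem integral_sum_sq_eq {ι κ : Type*} [Fintype ι] [Fintype κ] {P : Measure (ι → ℝ)} (b : ι → ℝ)
    (M : Matrix κ ι ℝ) (hP : ∀ k l, Integrable (fun w => (w k - b k) * (w l - b l)) P) :
    Integrable (fun w => ∑ i, (∑ j, M i j * (w j - b j)) ^ 2) P ∧
      ∫ w, ∑ i, (∑ j, M i j * (w j - b j)) ^ 2 ∂P
        = ∑ i, ∑ k, ∑ l, M i k * M i l * ∫ w, (w k - b k) * (w l - b l) ∂P := by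
  have hexp : ∀ w : ι → ℝ, ∑ i, (∑ j, M i j * (w j - b j)) ^ 2
      = ∑ i, ∑ k, ∑ l, M i k * M i l * ((w k - b k) * (w l - b l)) := fun w => by
    simp_rw [sq, Finset.sum_mul_sum]
    exact Finset.sum_congr rfl fun i _ => Finset.sum_congr rfl fun k _ =>
      Finset.sum_congr rfl fun l _ => by ring
  have h3 := fun i k l => (hP k l).const_mul (M i k * M i l)
  have h2 := fun i k => integrable_finsetSum Finset.univ fun l _ => h3 i k l
  have h1 := fun i => integrable_finsetSum Finset.univ fun k _ => h2 i k
  simp_rw [hexp]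
  refine ⟨integrable_finsetSum _ fun i _ => h1 i, ?_⟩
  rw [integral_finsetSum _ fun i _ => h1 i]
  refine Finset.sum_congr rfl fun i _ => ?_
  rw [integral_finsetSum _ fun k _ => h2 i k]
  refine Finset.sum_congr rfl fun k _ => ?_
  rw [integral_finsetSum _ fun l _ => h3 i k l]
  simp_rw [integral_const_mul]

theorem posDef_of_absolutelyContinuous {ι : Type*} [Fintype ι] {P : Measure (ι → ℝ)}
    [IsProbabilityMeasure P] (hac : P ≪ volume) (b : ι → ℝ)
    (hP : ∀ k l, Integrable (fun w => (w k - b k) * (w l - b l)) P) :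
    (Matrix.of fun k l => ∫ w, (w k - b k) * (w l - b l) ∂P).PosDef := by
  refine Matrix.PosDef.of_dotProduct_mulVec_pos ?_ fun v hv => ?_
  · ext k l
    simp [mul_comm]
  obtain ⟨hint, heq⟩ := integral_sum_sq_eq b (Matrix.of fun (_ : Unit) => v) hP
  simp only [Finset.univ_unique, Matrix.of_apply, Finset.sum_singleton] at hint heq
  have hq : star v ⬝ᵥ (Matrix.of fun k l => ∫ w, (w k - b k) * (w l - b l) ∂P).mulVec v
      = ∫ w, (∑ j, v j * (w j - b j)) ^ 2 ∂P := by
    rw [heq]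
    simp only [dotProduct, Matrix.mulVec, Matrix.of_apply, Finset.mul_sum, star_trivial]
    exact Finset.sum_congr rfl fun k _ => Finset.sum_congr rfl fun l _ => by ring
  rw [hq]
  refine lt_of_le_of_ne (integral_nonneg fun w => sq_nonneg _) fun h0 => ?_
  have hae := (integral_eq_zero_iff_of_nonneg (fun w => sq_nonneg _) hint).1 h0.symm
  let L : (ι → ℝ) →ₗ[ℝ] ℝ := Fintype.linearCombination ℝ v
  have hL : ∀ w, L w = ∑ j, w j * v j := fun w => by
    simp [L, Fintype.linearCombination_apply]
  have hker : LinearMap.ker L ≠ ⊤ := fun htop => by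
    refine hv (funext fun i => ?_)
    have : L (Pi.single i 1) = 0 := by
      rw [← LinearMap.mem_ker, htop]; trivial
    simpa [hL, Pi.single_apply] using this
  have hnull : volume ((fun w => w + -b) ⁻¹' (LinearMap.ker L : Set (ι → ℝ))) = 0 := by
    rw [measure_preimage_add_right]
    exact Measure.addHaar_submodule _ _ hker
  have hfalse : ∀ᵐ w ∂P, False := by
    filter_upwards [hae, measure_eq_zero_iff_ae_notMem.1 (hac hnull)] with w h1 h2
    refine h2 ?_
    simp only [Set.mem_preimage, SetLike.mem_coe, LinearMap.mem_ker, hL]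
    simpa [mul_comm, sub_eq_add_neg] using h1
  exact hfalse.exists.elim fun _ h => h

theorem Matrix.PosDef.exists_eq_mul_transpose {ι : Type*} [Fintype ι] [DecidableEq ι] {M : Matrix ι ι ℝ}
    (hM : M.PosDef) : ∃ C : Matrix ι ι ℝ, C * C.transpose = M ∧ C.det ≠ 0 := by
  open scoped MatrixOrder in
  obtain ⟨B, hB⟩ := CStarAlgebra.nonneg_iff_eq_star_mul_self.1 hM.posSemidef.nonneg
  have hB' : B.transpose * B = M := by rw [hB, Matrix.star_eq_conjTranspose,
    Matrix.conjTranspose_eq_transpose_of_trivial]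
  refine ⟨B.transpose, by rw [Matrix.transpose_transpose, hB'], fun h => hM.det_pos.ne' ?_⟩
  rw [← hB', Matrix.det_mul, h, zero_mul]

/-- A coupling of a law having mean `m` and covariance `A Aᵀ` with itself can be replaced by a
Gaussian self-coupling of `N(m, A Aᵀ)` with the same squared-error distortion, at the cost of at
most the non-Gaussianness of the marginal in mutual information. -/
theorem exists_gaussian_coupling {d : ℕ} (μ : Measure (Fin d → ℝ)) [IsProbabilityMeasure μ]
    (m : Fin d → ℝ) (A : Matrix (Fin d) (Fin d) ℝ) (hA : A.det ≠ 0)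
    (hL2 : ∀ i, MemLp (fun x => x i - m i) 2 μ)
    (hcov : ∀ i j, ∫ x, (x i - m i) * (x j - m j) ∂μ = (A * A.transpose) i j)
    (hKL : KL μ (affineGaussian m A) < ⊤) (π : Measure ((Fin d → ℝ) × (Fin d → ℝ)))
    [IsProbabilityMeasure π] (hfst : π.fst = μ) (hsnd : π.snd = μ)
    (hfin : KL π (μ.prod μ) < ⊤) :
    ∃ Q : Measure ((Fin d → ℝ) × (Fin d → ℝ)), IsProbabilityMeasure Q ∧
      Q.fst = affineGaussian m A ∧ Q.snd = affineGaussian m A ∧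
      (∫⁻ p, ENNReal.ofReal (∑ i, (p.1 i - p.2 i) ^ 2) ∂Q)
        = ∫⁻ p, ENNReal.ofReal (∑ i, (p.1 i - p.2 i) ^ 2) ∂π ∧
      KL Q ((affineGaussian m A).prod (affineGaussian m A))
        ≤ KL π (μ.prod μ) + KL μ (affineGaussian m A) := by
  let e := MeasurableEquiv.sumPiEquivProdPi fun _ : Fin d ⊕ Fin d => ℝ
  let b : Fin d ⊕ Fin d → ℝ := Sum.elim m m
  let R := Matrix.fromBlocks A 0 0 A
  have hR : R.det ≠ 0 := by
    rw [Matrix.det_fromBlocks_zero₂₁]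
    exact mul_ne_zero hA hA
  let P := π.map e.symm
  have hPprob : IsProbabilityMeasure P :=
    Measure.isProbabilityMeasure_map e.symm.measurable.aemeasurable
  have hPπ : P.map e = π := e.map_map_symm
  have hprod : (affineGaussian m A).prod (affineGaussian m A) = (affineGaussian b R).map e :=
    affineGaussian_prod m A
  have hπac : π ≪ (affineGaussian m A).prod (affineGaussian m A) :=
    (KL_lt_top_iff.1 hfin).1.trans ((KL_lt_top_iff.1 hKL).1.prod (KL_lt_top_iff.1 hKL).1)
  have hPac : P ≪ volume := by
    have h1 : P ≪ affineGaussian b R := by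
      have := hπac.map e.symm.measurable
      rw [hprod] at this
      rwa [e.map_symm_map] at this
    obtain ⟨c, hc⟩ := affineGaussian_eq_withDensity b hR
    rw [hc] at h1
    exact h1.trans (withDensity_absolutelyContinuous _ _)
  have hp1 : MeasurePreserving (fun w : Fin d ⊕ Fin d → ℝ => fun i => w (Sum.inl i)) P μ := by
    refine ⟨measurable_pi_lambda _ fun i => by fun_prop, ?_⟩
    rw [← hfst, Measure.fst, ← hPπ, Measure.map_map measurable_fst e.measurable]
    rfl
  have hp2 : MeasurePreserving (fun w : Fin d ⊕ Fin d → ℝ => fun i => w (Sum.inr i)) P μ := by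
    refine ⟨measurable_pi_lambda _ fun i => by fun_prop, ?_⟩
    rw [← hsnd, Measure.snd, ← hPπ, Measure.map_map measurable_snd e.measurable]
    rfl
  have hPL2 : ∀ k, MemLp (fun w => w k - b k) 2 P := by
    rintro (i | i)
    · exact (hL2 i).comp_measurePreserving hp1
    · exact (hL2 i).comp_measurePreserving hp2
  have hPint : ∀ k l, Integrable (fun w => (w k - b k) * (w l - b l)) P :=
    fun k l => (hPL2 k).integrable_mul (hPL2 l)
  obtain ⟨C, hCC, hC⟩ := (posDef_of_absolutelyContinuous hPac b hPint).exists_eq_mul_transpose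
  have hCC' : ∀ k l, (C * C.transpose) k l = ∫ w, (w k - b k) * (w l - b l) ∂P :=
    fun k l => by rw [hCC]; rfl
  have hQint := fun k l => (secondMoment_affineGaussian b C k l).1
  have hquad : ∀ {κ : Type} [Fintype κ] (M : Matrix κ (Fin d ⊕ Fin d) ℝ),
      ∫ w, ∑ i, (∑ j, M i j * (w j - b j)) ^ 2 ∂P
        = ∫ w, ∑ i, (∑ j, M i j * (w j - b j)) ^ 2 ∂(affineGaussian b C) := fun M => by
    rw [(integral_sum_sq_eq b M hPint).2, (integral_sum_sq_eq b M hQint).2]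
    simp_rw [(secondMoment_affineGaussian b C _ _).2, hCC']
  have hQprob : IsProbabilityMeasure ((affineGaussian b C).map e) :=
    Measure.isProbabilityMeasure_map e.measurable.aemeasurable
  have hQfst : ((affineGaussian b C).map e).fst = affineGaussian m A := by
    refine (fst_map_affineGaussian m m C).trans (affineGaussian_congr m ?_)
    ext i j
    rw [← hcov, ← hp1.map_eq, integral_map hp1.measurable.aemeasurable (by fun_prop)]
    exact hCC' (Sum.inl i) (Sum.inl j)
  have hQsnd : ((affineGaussian b C).map e).snd = affineGaussian m A := by
    refine (snd_map_affineGaussian m m C).trans (affineGaussian_congr m ?_)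
    ext i j
    rw [← hcov, ← hp2.map_eq, integral_map hp2.measurable.aemeasurable (by fun_prop)]
    exact hCC' (Sum.inr i) (Sum.inr j)
  refine ⟨(affineGaussian b C).map e, hQprob, hQfst, hQsnd, ?_, ?_⟩
  · let M : Matrix (Fin d) (Fin d ⊕ Fin d) ℝ := Matrix.fromCols 1 (-1)
    have hM : ∀ w, ∑ i, ((e w).1 i - (e w).2 i) ^ 2
        = ∑ i, (∑ j, M i j * (w j - b j)) ^ 2 := fun w => by
      refine Finset.sum_congr rfl fun i _ => ?_
      congr 1
      simp only [Fintype.sum_sum_type, M, b, Matrix.fromCols_apply_inl, Matrix.fromCols_apply_inr,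
        Matrix.neg_apply, Matrix.one_apply, Sum.elim_inl, Sum.elim_inr, ite_mul, neg_mul,
        Finset.sum_neg_distrib, one_mul, zero_mul, Finset.sum_ite_eq, Finset.mem_univ, if_true]
      change w (Sum.inl i) - w (Sum.inr i) = _
      ring
    have hd : ∀ T : Measure (Fin d ⊕ Fin d → ℝ),
        (∀ k l, Integrable (fun w => (w k - b k) * (w l - b l)) T) →
        ∫⁻ p, ENNReal.ofReal (∑ i, (p.1 i - p.2 i) ^ 2) ∂(T.map e)
          = ENNReal.ofReal (∫ w, ∑ i, (∑ j, M i j * (w j - b j)) ^ 2 ∂T) := fun T hT => by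
      rw [lintegral_map_equiv, ofReal_integral_eq_lintegral_ofReal (integral_sum_sq_eq b M hT).1
        (ae_of_all _ fun w => Finset.sum_nonneg fun i _ => sq_nonneg _)]
      simp_rw [hM]
    rw [hd _ hQint, ← hPπ, hd _ hPint, hquad]
  · obtain ⟨c, hc⟩ := affineGaussian_eq_withDensity_affineGaussian b hC hR
    let f : (Fin d ⊕ Fin d → ℝ) → ℝ := fun w => c - (∑ i, (∑ j, C⁻¹ i j * (w j - b j)) ^ 2) / 2
        + (∑ i, (∑ j, R⁻¹ i j * (w j - b j)) ^ 2) / 2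
    have hf : Measurable f := by fun_prop
    have hfT : ∀ T : Measure (Fin d ⊕ Fin d → ℝ), IsProbabilityMeasure T →
        (∀ k l, Integrable (fun w => (w k - b k) * (w l - b l)) T) →
        Integrable (f ∘ e.symm) (T.map e) ∧ ∫ p, (f ∘ e.symm) p ∂(T.map e)
          = c - (∫ w, ∑ i, (∑ j, C⁻¹ i j * (w j - b j)) ^ 2 ∂T) / 2
            + (∫ w, ∑ i, (∑ j, R⁻¹ i j * (w j - b j)) ^ 2 ∂T) / 2 := fun T _ hT => by
      have h1 := (integral_sum_sq_eq b C⁻¹ hT).1.div_const 2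
      have h2 := (integral_sum_sq_eq b R⁻¹ hT).1.div_const 2
      have h0 : Integrable (fun _ : Fin d ⊕ Fin d → ℝ => c) T := integrable_const c
      rw [integrable_map_equiv, integral_map_equiv]
      simp only [Function.comp_def, e.symm_apply_apply]
      refine ⟨(h0.sub h1).add h2, ?_⟩
      refine (integral_add (h0.sub h1) h2).trans ?_
      rw [integral_div]
      congr 1
      refine (integral_sub h0 h1).trans ?_
      rw [integral_div, integral_const]
      simp
    have hfP := hfT P hPprob hPint
    have hfQ := hfT (affineGaussian b C) inferInstance hQint
    rw [hPπ] at hfP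
    refine KL_le_add_of_integral_eq hfst hsnd hQfst hKL hfin (hf.comp e.symm.measurable) ?_
      hfP.1 hfQ.1 (by rw [hfP.2, hfQ.2, hquad, hquad])
    rw [hprod, hc, map_withDensity_of_leftInverse _ (by fun_prop) e.measurable e.symm.measurable
      e.symm_apply_apply]
    rfl

/-- Shannon lower bound for the perfect-realism RDPF under mean-squared-error distortion:
`R_PR(μ, D) ≥ R_PR(N(m,Σ), D) − KL(μ ∥ N(m,Σ))`.  The Gaussian measure `N(m,Σ)` is
characterized as the pushforward of a product of standard Gaussians under
`x ↦ m + A x` where `A Aᵀ = Σ`. -/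
theorem stmt11 {d : ℕ} (μ : Measure (Fin d → ℝ)) [IsProbabilityMeasure μ]
    (m : Fin d → ℝ) (S : Matrix (Fin d) (Fin d) ℝ) (hS : S.PosDef)
    (hmean : ∀ i, ∫ x, x i ∂μ = m i)
    (hcov : ∀ i j, ∫ x, (x i - m i) * (x j - m j) ∂μ = S i j)
    (A : Matrix (Fin d) (Fin d) ℝ) (hA : A * A.transpose = S)
    (gauss : Measure (Fin d → ℝ))
    (hgauss : gauss = (Measure.pi fun _ : Fin d => ProbabilityTheory.gaussianReal 0 1).map
        (fun x i => m i + ∑ j, A i j * x j))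
    (hKLfin : KL μ gauss < ⊤) (D : ℝ) (hD : 0 < D) :
    RPR gauss D - KL μ gauss ≤ RPR μ D := by
  change gauss = affineGaussian m A at hgauss
  subst hgauss
  have hdet : A.det ≠ 0 := fun h => hS.det_pos.ne' (by rw [← hA, Matrix.det_mul, h, zero_mul])
  have hL2 : ∀ i, MemLp (fun x => x i - m i) 2 μ := fun i => by
    have hm : Measurable (fun x : Fin d → ℝ => x i - m i) :=
      (measurable_pi_apply i).sub measurable_const
    have hmeas := hm.aestronglyMeasurable (μ := μ)
    rw [memLp_two_iff_integrable_sq hmeas]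
    by_contra hni
    have h0 := hcov i i
    simp_rw [← sq] at h0
    rw [integral_undef hni] at h0
    exact hS.diag_pos.ne h0
  rw [tsub_le_iff_right]
  rw [RPR, RPR, ENNReal.sInf_add]
  refine le_iInf₂ fun r hr => ?_
  obtain ⟨π, hπ, hfst, hsnd, hdist, rfl⟩ := hr
  rcases eq_top_or_lt_top (KL π (μ.prod μ)) with htop | hfin
  · simp [htop]
  obtain ⟨Q, hQ, hQfst, hQsnd, hQdist, hQKL⟩ := exists_gaussian_coupling μ m A hdet hL2
    (fun i j => by rw [hcov, hA]) hKLfin π hfst hsnd hfin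
  refine le_trans (sInf_le ?_) hQKL
  exact ⟨Q, hQ, hQfst, hQsnd, hQdist.trans_le hdist, rfl⟩
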